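/- Let G=(V,w,m,d) be a salami with connected salami partition P=(X,Y,K). Suppose f ∈ ℱ(P) satisfies Δf(x) = c for all x ∈ K, for some constant c ∈ ℝ. Then c = 0. -/

import Mathlib

open Filter

namespace SalamiPaper

variable {V : Type*}

/-- Locally finite: every vertex has finitely many neighbors. -/
def LocallyFinite (w : V → V → ℝ) : Prop := ∀ x : V, {y | 0 < w x y}.Finite

/-- Connectedness of the weighted graph: any two vertices are joined by a path. -/
def GraphConnected (w : V → V → ℝ) : Prop :=
  ∀ x y : V, Relation.ReflTransGen (fun a b => 0 < w a b) x y

/-- The weighted graph Laplacian `Δf(x) = (1/m(x)) ∑_y w(x,y)(f(y)-f(x))`. -/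
noncomputable def lap (w : V → V → ℝ) (m : V → ℝ) (f : V → ℝ) (x : V) : ℝ :=
  (m x)⁻¹ * ∑ᶠ y, w x y * (f y - f x)

/-- The vertex degree `Deg(x) = (1/m(x)) ∑_y w(x,y)`. -/
noncomputable def deg (w : V → V → ℝ) (m : V → ℝ) (x : V) : ℝ :=
  (m x)⁻¹ * ∑ᶠ y, w x y

/-- The set of `d`-lengths of adjacency paths from `x` to `y`. -/
def pathLens (w : V → V → ℝ) (d : V → V → ℝ) (x y : V) : Set ℝ :=
  {L | ∃ (n : ℕ) (p : ℕ → V), p 0 = x ∧ p n = y ∧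
    (∀ i < n, 0 < w (p i) (p (i + 1))) ∧
    L = ∑ i ∈ Finset.range n, d (p i) (p (i + 1))}

/-- `d` is a path metric on the graph with edge weight `w`. -/
def IsPathMetric (w : V → V → ℝ) (d : V → V → ℝ) : Prop :=
  (∀ x, d x x = 0) ∧ (∀ x y, x ≠ y → 0 < d x y) ∧ (∀ x y, d x y = d y x) ∧
  (∀ x y z, d x z ≤ d x y + d y z) ∧
  (∀ x y, d x y = sInf (pathLens w d x y))

/-- All balls are finite. -/
def FiniteBalls (d : V → V → ℝ) : Prop := ∀ (x : V) (R : ℝ), {y | d x y ≤ R}.Finite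

/-- The combinatorial graph distance (as a real number). -/
noncomputable def combDist (w : V → V → ℝ) (x y : V) : ℝ :=
  sInf {L | ∃ (n : ℕ) (p : ℕ → V), p 0 = x ∧ p n = y ∧
    (∀ i < n, 0 < w (p i) (p (i + 1))) ∧ L = (n : ℝ)}

/-- `Lip(1)`: the 1-Lipschitz functions with respect to `d`. -/
def Lip1 (d : V → V → ℝ) (f : V → ℝ) : Prop := ∀ x y, f y - f x ≤ d x y

/-- The Ollivier curvature
`κ(x,y) = (1/d(x,y)) inf{Δf(x) - Δf(y) : f ∈ Lip(1), f(y)-f(x) = d(x,y)}`. -/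
noncomputable def kappa (w : V → V → ℝ) (m : V → ℝ) (d : V → V → ℝ) (x y : V) : ℝ :=
  (d x y)⁻¹ * sInf {c | ∃ f : V → ℝ, Lip1 d f ∧ f y - f x = d x y ∧
    c = lap w m f x - lap w m f y}

/-- `m(A) = ∞`: the total measure of `A` is infinite. -/
def InfVolume (m : V → ℝ) (A : Set V) : Prop :=
  ∀ c : ℝ, ∃ F : Finset V, ↑F ⊆ A ∧ c < ∑ x ∈ F, m x

/-- A salami partition `(X,Y,K)`. -/
def SalamiPartition (w : V → V → ℝ) (m : V → ℝ) (X Y K : Set V) : Prop :=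
  X ∪ Y ∪ K = Set.univ ∧ Disjoint X Y ∧ Disjoint X K ∧ Disjoint Y K ∧
  K.Finite ∧ (∀ x ∈ X, ∀ y ∈ Y, w x y = 0) ∧ InfVolume m X ∧ InfVolume m Y

/-- Reachability inside a subset `A` of the vertex set. -/
def reachIn (w : V → V → ℝ) (A : Set V) : V → V → Prop :=
  Relation.ReflTransGen (fun a b => a ∈ A ∧ b ∈ A ∧ 0 < w a b)

/-- The induced subgraph on `A` is connected. -/
def ConnectedIn (w : V → V → ℝ) (A : Set V) : Prop :=
  ∀ x ∈ A, ∀ y ∈ A, reachIn w A x y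

/-- A connected salami partition: `K` induces a connected subgraph. -/
def ConnectedSalamiPartition (w : V → V → ℝ) (m : V → ℝ) (X Y K : Set V) : Prop :=
  SalamiPartition w m X Y K ∧ ConnectedIn w K

/-- The basic standing assumptions on a weighted graph `G = (V,w,m,d)`:
countable vertex set, symmetric non-negative edge weight vanishing on the diagonal,
positive vertex measure, local finiteness, connectedness,
`d` a path metric with finite balls. -/
def IsGraphBase (w : V → V → ℝ) (m : V → ℝ) (d : V → V → ℝ) : Prop :=
  Countable V ∧ (∀ x y, w x y = w y x) ∧ (∀ x y, 0 ≤ w x y) ∧ (∀ x, w x x = 0) ∧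
  (∀ x, 0 < m x) ∧ LocallyFinite w ∧ GraphConnected w ∧
  IsPathMetric w d ∧ FiniteBalls d

/-- Non-negative Ollivier curvature on all edges. -/
def NonnegCurv (w : V → V → ℝ) (m : V → ℝ) (d : V → V → ℝ) : Prop :=
  ∀ x y, 0 < w x y → 0 ≤ kappa w m d x y

/-- A salami: a connected, locally finite weighted graph with a path metric with
finite balls, non-negative Ollivier curvature, admitting a salami partition. -/
def IsSalami (w : V → V → ℝ) (m : V → ℝ) (d : V → V → ℝ) : Prop :=
  IsGraphBase w m d ∧ NonnegCurv w m d ∧ ∃ X Y K : Set V, SalamiPartition w m X Y K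

/-- `G` has at least `n` ends: there is a finite set `K` such that `V ∖ K` has at
least `n` infinite connected components. -/
def atLeastEnds (w : V → V → ℝ) (n : ℕ) : Prop :=
  ∃ K : Set V, K.Finite ∧ ∃ x : Fin n → V,
    (∀ i, x i ∉ K) ∧ (∀ i, {y | reachIn w Kᶜ (x i) y}.Infinite) ∧
    (∀ i j, i ≠ j → ¬ reachIn w Kᶜ (x i) (x j))

/-- `Lip(1,K)`: functions that are 1-Lipschitz on `K`. -/
def Lip1On (d : V → V → ℝ) (K : Set V) (f : V → ℝ) : Prop :=
  ∀ x ∈ K, ∀ y ∈ K, f y - f x ≤ d x y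

open Classical in
/-- The extremal Lipschitz extension operator `S(P)` of the salami partition
`P = (X,Y,K)`. -/
noncomputable def Sop (d : V → V → ℝ) (X Y K : Set V) (f : V → ℝ) : V → ℝ :=
  fun v =>
    if v ∈ K then f v
    else if v ∈ X then sSup {c | ∃ u ∈ K, c = f u - d v u}
    else sInf {c | ∃ u ∈ K, c = f u + d v u}

/-- `ℱ(P) = S(P)(Lip(1,K))`. -/
def calF (d : V → V → ℝ) (X Y K : Set V) : Set (V → ℝ) :=
  {g | ∃ f : V → ℝ, Lip1On d K f ∧ g = Sop d X Y K f}

/-- `ℋ(P)`: the harmonic functions in `ℱ(P)`. -/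
def calH (w : V → V → ℝ) (m : V → ℝ) (d : V → V → ℝ) (X Y K : Set V) :
    Set (V → ℝ) :=
  {g | g ∈ calF d X Y K ∧ ∀ x, lap w m g x = 0}

/-- `∇₊f(x) = max_{y∼x} (f(y)-f(x))/d(x,y)`. -/
noncomputable def gradPlus (w : V → V → ℝ) (d : V → V → ℝ) (f : V → ℝ) (x : V) : ℝ :=
  sSup {c | ∃ y, 0 < w x y ∧ c = (f y - f x) / d x y}

/-- `∇₋f(x) = max_{y∼x} (f(x)-f(y))/d(x,y)`. -/
noncomputable def gradMinus (w : V → V → ℝ) (d : V → V → ℝ) (f : V → ℝ) (x : V) : ℝ :=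
  sSup {c | ∃ y, 0 < w x y ∧ c = (f x - f y) / d x y}

/-- `|∇f|(x) = max_{y∼x} |f(y)-f(x)|/d(x,y)`. -/
noncomputable def gradAbs (w : V → V → ℝ) (d : V → V → ℝ) (f : V → ℝ) (x : V) : ℝ :=
  sSup {c | ∃ y, 0 < w x y ∧ c = |f y - f x| / d x y}

/-- Recurrence: for every `ε > 0` there is a finitely supported `f` with
`‖f‖∞ = 1` and `-⟨f, Δf⟩ < ε`. -/
def Recurrent (w : V → V → ℝ) (m : V → ℝ) : Prop :=
  ∀ ε : ℝ, 0 < ε → ∃ f : V → ℝ, (Function.support f).Finite ∧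
    (∀ x, |f x| ≤ 1) ∧ (∃ x, |f x| = 1) ∧
    -(∑ᶠ x, f x * lap w m f x * m x) < ε

open Classical in
/-- `∑_{x,y : f(y) < 0 ≤ f(x)} w(x,y)(f(x)-f(y))`. -/
noncomputable def cutSum (w : V → V → ℝ) (f : V → ℝ) : ℝ :=
  ∑ᶠ p : V × V, if f p.2 < 0 ∧ 0 ≤ f p.1 then w p.1 p.2 * (f p.1 - f p.2) else 0

/-- Subexponential growth: `max_{B_r(x)} |u| = e^{o(r)}` as `r → ∞`. -/
def SubexpGrowth (d : V → V → ℝ) (x : V) (u : V → ℝ) : Prop :=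
  Filter.Tendsto
    (fun r : ℕ => Real.log (sSup {c | ∃ y, d x y ≤ (r : ℝ) ∧ c = |u y|}) / (r : ℝ))
    Filter.atTop (nhds 0)


theorem IsGraphBase.pathLens_nonempty {w : V → V → ℝ} {m : V → ℝ} {d : V → V → ℝ}
    (hG : IsGraphBase w m d) (x y : V) : (pathLens w d x y).Nonempty := by
  obtain ⟨-, -, -, -, -, -, hconn, -, -⟩ := hG
  suffices h : ∃ (n : ℕ) (p : ℕ → V), p 0 = x ∧ p n = y ∧
      ∀ i < n, 0 < w (p i) (p (i + 1)) by
    obtain ⟨n, p, h0, hn, hp⟩ := h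
    exact ⟨_, n, p, h0, hn, hp, rfl⟩
  induction hconn x y with
  | refl => exact ⟨0, fun _ => x, rfl, rfl, by simp⟩
  | @tail b c _ hbc ih =>
    obtain ⟨n, p, h0, hn, hp⟩ := ih
    refine ⟨n + 1, fun i => if i ≤ n then p i else c, by simpa using h0, by simp, ?_⟩
    intro i hi
    rcases Nat.lt_succ_iff_lt_or_eq.mp hi with h | h
    · simpa [h.le, Nat.succ_le_of_lt h] using hp i h
    · subst h
      simpa [hn] using hbc

/-- For a path metric, the Lipschitz condition only has to be checked on edges. -/
theorem IsGraphBase.lip1_of_adj {w : V → V → ℝ} {m : V → ℝ} {d : V → V → ℝ}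
    (hG : IsGraphBase w m d) {f : V → ℝ} (hf : ∀ x y, 0 < w x y → f y - f x ≤ d x y) :
    Lip1 d f := by
  intro x y
  have hne := hG.pathLens_nonempty x y
  obtain ⟨-, -, -, -, -, -, -, ⟨-, -, -, -, hpath⟩, -⟩ := hG
  rw [hpath x y]
  refine le_csInf hne ?_
  rintro L ⟨n, p, rfl, rfl, hp, rfl⟩
  rw [← Finset.sum_range_sub (fun i => f (p i))]
  exact Finset.sum_le_sum fun i hi => hf _ _ (hp i (Finset.mem_range.mp hi))

/-- Between distinct points there is a first step of a geodesic. -/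
theorem IsGraphBase.exists_adj_dist_add {w : V → V → ℝ} {m : V → ℝ} {d : V → V → ℝ}
    (hG : IsGraphBase w m d) {x y : V} (hxy : x ≠ y) :
    ∃ z, 0 < w x z ∧ d x z + d z y ≤ d x y := by
  have hne := hG.pathLens_nonempty x y
  obtain ⟨-, -, -, -, -, hfin, -, ⟨hd0, -, -, htri, hpath⟩, -⟩ := hG
  have hstep : ∀ L ∈ pathLens w d x y, ∃ z, 0 < w x z ∧ d x z + d z y ≤ L := by
    rintro L ⟨n, p, rfl, rfl, hp, rfl⟩
    obtain _ | n := n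
    · exact absurd rfl hxy
    refine ⟨p 1, hp 0 n.succ_pos, ?_⟩
    have htail : ∀ k, d (p 1) (p (k + 1)) ≤
        ∑ i ∈ Finset.range k, d (p (i + 1)) (p (i + 1 + 1)) := by
      intro k
      induction k with
      | zero => simp [hd0]
      | succ k ih =>
        rw [Finset.sum_range_succ]
        linarith [htri (p 1) (p (k + 1)) (p (k + 1 + 1))]
    rw [Finset.sum_range_succ']
    linarith [htail n]
  have hnbr : {z | 0 < w x z}.Nonempty := by
    obtain ⟨L, hL⟩ := hne
    obtain ⟨z, hz, -⟩ := hstep L hL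
    exact ⟨z, hz⟩
  obtain ⟨z, hz, hmin⟩ := Set.exists_min_image _ (fun z => d x z + d z y) (hfin x) hnbr
  refine ⟨z, hz, ?_⟩
  rw [hpath x y]
  refine le_csInf hne fun L hL => ?_
  obtain ⟨z', hz', hle⟩ := hstep L hL
  exact (hmin z' hz').trans hle

theorem finsum_weight_mul_eq_sum {w : V → V → ℝ} (hw : ∀ x y, 0 ≤ w x y) {x : V} {N : Finset V}
    (hN : ∀ y, 0 < w x y → y ∈ N) (g : V → ℝ) :
    ∑ᶠ y, w x y * g y = ∑ y ∈ N, w x y * g y := by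
  refine finsum_eq_sum_of_support_subset _ fun y hy => hN y ?_
  exact (hw x y).lt_of_ne' (left_ne_zero_of_mul hy)

theorem lap_neg (w : V → V → ℝ) (m : V → ℝ) (f : V → ℝ) (x : V) :
    lap w m (-f) x = -lap w m f x := by
  unfold lap
  rw [← mul_neg, ← finsum_neg_distrib]
  congr 2
  funext y
  simp only [Pi.neg_apply]
  ring

theorem IsGraphBase.exists_abs_lap_le {w : V → V → ℝ} {m : V → ℝ} {d : V → V → ℝ}
    (hG : IsGraphBase w m d) (x : V) : ∃ C : ℝ, ∀ f, Lip1 d f → |lap w m f x| ≤ C := by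
  obtain ⟨-, -, hw, -, hm, hfin, -, ⟨-, -, hsymm, -, -⟩, -⟩ := hG
  refine ⟨(m x)⁻¹ * ∑ y ∈ (hfin x).toFinset, w x y * d x y, fun f hf => ?_⟩
  unfold lap
  rw [finsum_weight_mul_eq_sum hw (N := (hfin x).toFinset) (by simp), abs_mul,
    abs_of_pos (inv_pos.mpr (hm x))]
  refine mul_le_mul_of_nonneg_left ?_ (inv_pos.mpr (hm x)).le
  refine (Finset.abs_sum_le_sum_abs _ _).trans (Finset.sum_le_sum fun y _ => ?_)
  rw [abs_mul, abs_of_nonneg (hw x y)]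
  refine mul_le_mul_of_nonneg_left (abs_le.mpr ⟨?_, hf x y⟩) (hw x y)
  linarith [hf y x, hsymm x y]

theorem IsGraphBase.lap_le_of_adj {w : V → V → ℝ} {m : V → ℝ} {d : V → V → ℝ}
    (hG : IsGraphBase w m d) (hκ : NonnegCurv w m d) {f : V → ℝ} (hf : Lip1 d f) {x y : V}
    (hxy : 0 < w x y) (h : f y - f x = d x y) : lap w m f y ≤ lap w m f x := by
  obtain ⟨C, hC⟩ := hG.exists_abs_lap_le x
  obtain ⟨D, hD⟩ := hG.exists_abs_lap_le y
  obtain ⟨-, -, -, hw0, -, -, -, ⟨-, hpos, -, -, -⟩, -⟩ := hG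
  have hne : x ≠ y := by
    rintro rfl
    exact hxy.ne' (hw0 x)
  have hinf := hκ x y hxy
  rw [kappa, mul_nonneg_iff_of_pos_left (inv_pos.mpr (hpos x y hne))] at hinf
  have hbdd : BddBelow {c | ∃ f : V → ℝ, Lip1 d f ∧ f y - f x = d x y ∧
      c = lap w m f x - lap w m f y} := by
    refine ⟨-C - D, ?_⟩
    rintro _ ⟨g, hg, -, rfl⟩
    linarith [(abs_le.mp (hC g hg)).1, (abs_le.mp (hD g hg)).2]
  linarith [csInf_le hbdd ⟨f, hf, h, rfl⟩]

/-- Non-negative curvature makes the Laplacian of a Lipschitz function monotone along any pair of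
points at which the Lipschitz bound is attained. -/
theorem IsGraphBase.lap_le_of_sub_eq_dist {w : V → V → ℝ} {m : V → ℝ} {d : V → V → ℝ}
    (hG : IsGraphBase w m d) (hκ : NonnegCurv w m d) {f : V → ℝ} (hf : Lip1 d f) {x y : V}
    (h : f y - f x = d x y) : lap w m f y ≤ lap w m f x := by
  have hG' := hG
  obtain ⟨-, -, -, hw0, -, -, -, ⟨-, hpos, hsymm, -, -⟩, hballs⟩ := hG'
  induction hn : {z | d y z ≤ d y x}.ncard using Nat.strong_induction_on generalizing x with
  | _ n ih =>
    by_cases hxy : x = y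
    · rw [hxy]
    obtain ⟨z, hz, hle⟩ := hG.exists_adj_dist_add hxy
    have hxz : x ≠ z := by
      rintro rfl
      exact hz.ne' (hw0 x)
    have hlt : d y z < d y x := by
      linarith [hpos x z hxz, hsymm y z, hsymm y x]
    have h1 : f z - f x = d x z := by linarith [hf x z, hf z y]
    have h2 : f y - f z = d z y := by linarith [hf x z, hf z y]
    have hcard : {u | d y u ≤ d y z}.ncard < n := by
      rw [← hn]
      refine Set.ncard_lt_ncard ⟨fun u hu => le_trans hu hlt.le, fun hsub => ?_⟩ (hballs _ _)
      exact absurd (hsub (show d y x ≤ d y x from le_rfl)) (not_le.mpr hlt)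
    exact (ih _ hcard h2 rfl).trans (hG.lap_le_of_adj hκ hf hz h1)

open Classical in
/-- A function with finite superlevel sets on a set `S` of infinite volume with finite inner
boundary cannot have Laplacian bounded below by a positive constant on `S`. -/
theorem IsGraphBase.nonpos_of_le_lap {w : V → V → ℝ} {m : V → ℝ} {d : V → V → ℝ}
    (hG : IsGraphBase w m d) {S K : Set V} (hK : K.Finite)
    (hSK : ∀ x ∈ S, ∀ y ∉ S, 0 < w x y → x ∈ K) (hS : InfVolume m S) {f : V → ℝ}
    (hf : ∀ R, {x | x ∈ S ∧ R ≤ f x}.Finite) {c : ℝ} (hc : ∀ x ∈ S, c ≤ lap w m f x) :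
    c ≤ 0 := by
  by_contra! hpos
  obtain ⟨-, hsymm, hw, -, hm, hfin, -, -, -⟩ := hG
  set B : V → ℝ := fun x => ∑ y ∈ (hfin x).toFinset, w x y * |f y - f x| with hB
  have hB0 : ∀ x, 0 ≤ B x := fun x =>
    Finset.sum_nonneg fun y _ => mul_nonneg (hw x y) (abs_nonneg _)
  obtain ⟨F, hFS, hF⟩ := hS ((∑ x ∈ hK.toFinset, B x) / c)
  obtain ⟨R, hR⟩ : ∃ R, ∀ x ∈ F, R ≤ f x := by
    obtain ⟨R, hR⟩ := (F.image f).bddBelow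
    exact ⟨R, fun x hx => hR (Finset.mem_coe.mpr (Finset.mem_image_of_mem f hx))⟩
  set T := (hf R).toFinset with hT
  have hmemT : ∀ x, x ∈ T ↔ x ∈ S ∧ R ≤ f x := fun x => by simp [hT]
  set N := T ∪ T.biUnion fun x => (hfin x).toFinset
  have hNmem : ∀ x ∈ T, ∀ y, 0 < w x y → y ∈ N := fun x hx y hy =>
    Finset.mem_union_right _ (Finset.mem_biUnion.mpr ⟨x, hx, by simpa using hy⟩)
  have hflux : ∀ x ∈ T, c * m x ≤
      ∑ y ∈ T, w x y * (f y - f x) + if x ∈ K then B x else 0 := by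
    intro x hx
    obtain ⟨hxS, hxR⟩ := (hmemT x).mp hx
    have hlap : m x * lap w m f x = ∑ y ∈ N, w x y * (f y - f x) := by
      unfold lap
      rw [mul_inv_cancel_left₀ (hm x).ne']
      exact finsum_weight_mul_eq_sum hw (hNmem x hx) fun y => f y - f x
    have hout : ∑ y ∈ N \ T, w x y * (f y - f x) ≤ if x ∈ K then B x else 0 := by
      split_ifs with hxK
      · have hBN : B x = ∑ y ∈ N, w x y * |f y - f x| := by
          rw [hB, ← finsum_weight_mul_eq_sum hw (hNmem x hx) fun y => |f y - f x|]
          exact (finsum_weight_mul_eq_sum hw (by simp) fun y => |f y - f x|).symm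
        rw [hBN]
        refine (Finset.sum_le_sum fun y _ =>
          mul_le_mul_of_nonneg_left (le_abs_self _) (hw x y)).trans ?_
        exact Finset.sum_le_sum_of_subset_of_nonneg Finset.sdiff_subset
          fun y _ _ => mul_nonneg (hw x y) (abs_nonneg _)
      · refine Finset.sum_nonpos fun y hy => ?_
        have hyT := (Finset.mem_sdiff.mp hy).2
        rw [hmemT] at hyT
        by_cases hyS : y ∈ S
        · have : f y < R := not_le.mp fun h => hyT ⟨hyS, h⟩
          exact mul_nonpos_of_nonneg_of_nonpos (hw x y) (by linarith)
        · have : w x y = 0 := by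
            by_contra hne
            exact hxK (hSK x hxS y hyS ((hw x y).lt_of_ne' hne))
          simp [this]
    have hsplit := Finset.sum_sdiff (f := fun y => w x y * (f y - f x))
      (show T ⊆ N from Finset.subset_union_left)
    have hcm := mul_le_mul_of_nonneg_left (hc x hxS) (hm x).le
    linarith
  have hanti : ∑ x ∈ T, ∑ y ∈ T, w x y * (f y - f x) = 0 := by
    have h : ∑ x ∈ T, ∑ y ∈ T, w x y * (f y - f x) =
        -∑ x ∈ T, ∑ y ∈ T, w x y * (f y - f x) := by
      conv_lhs => rw [Finset.sum_comm]
      rw [← Finset.sum_neg_distrib]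
      refine Finset.sum_congr rfl fun x _ => ?_
      rw [← Finset.sum_neg_distrib]
      refine Finset.sum_congr rfl fun y _ => ?_
      rw [hsymm y x]
      ring
    linarith
  have hsum := Finset.sum_le_sum hflux
  rw [Finset.sum_add_distrib, hanti, zero_add, ← Finset.mul_sum, ← Finset.sum_filter] at hsum
  have hbound : ∑ x ∈ T with x ∈ K, B x ≤ ∑ x ∈ hK.toFinset, B x :=
    Finset.sum_le_sum_of_subset_of_nonneg
      (fun x hx => hK.mem_toFinset.mpr (Finset.mem_filter.mp hx).2) fun x _ _ => hB0 x
  have hFT : ∑ x ∈ F, m x ≤ ∑ x ∈ T, m x :=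
    Finset.sum_le_sum_of_subset_of_nonneg
      (fun x hx => (hmemT x).mpr ⟨hFS (Finset.mem_coe.mpr hx), hR x hx⟩) fun x _ _ => (hm x).le
  rw [div_lt_iff₀ hpos] at hF
  nlinarith

theorem InfVolume.nonempty {m : V → ℝ} {A : Set V} (h : InfVolume m A) : A.Nonempty := by
  obtain ⟨F, hFA, hF⟩ := h 0
  obtain ⟨x, hx⟩ : F.Nonempty := by
    rw [Finset.nonempty_iff_ne_empty]
    rintro rfl
    simp at hF
  exact ⟨x, hFA hx⟩

theorem InfVolume.mono {m : V → ℝ} {A B : Set V} (hAB : A ⊆ B) (h : InfVolume m A) :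
    InfVolume m B := fun c =>
  let ⟨F, hFA, hF⟩ := h c
  ⟨F, hFA.trans hAB, hF⟩

theorem SalamiPartition.nonempty {w : V → V → ℝ} {m : V → ℝ} {X Y K : Set V}
    (hP : SalamiPartition w m X Y K) (hconn : GraphConnected w) : K.Nonempty := by
  obtain ⟨hcover, hXY, -, -, -, hw, hX, hY⟩ := hP
  by_contra! hK
  obtain ⟨x, hx⟩ := hX.nonempty
  obtain ⟨y, hy⟩ := hY.nonempty
  suffices h : ∀ z, Relation.ReflTransGen (fun a b => 0 < w a b) x z → z ∈ X from
    Set.disjoint_left.mp hXY (h y (hconn x y)) hy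
  intro z hz
  induction hz with
  | refl => exact hx
  | @tail b c _ hbc ih =>
    rcases hcover.symm.subset (Set.mem_univ c) with (h | h) | h
    · exact h
    · exact absurd (hw b ih c h) hbc.ne'
    · simp [hK] at h

/-- The values of the extremal extension on the three parts. -/
theorem Sop_spec {w : V → V → ℝ} {m : V → ℝ} {d : V → V → ℝ} {X Y K : Set V} (hP : SalamiPartition w m X Y K)
    (hK : K.Nonempty) (f : V → ℝ) :
    (∀ v ∈ K, Sop d X Y K f v = f v) ∧
    (∀ v ∈ X, (∃ u ∈ K, Sop d X Y K f v = f u - d v u) ∧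
      ∀ u ∈ K, f u - d v u ≤ Sop d X Y K f v) ∧
    ∀ v ∈ Y, (∃ u ∈ K, Sop d X Y K f v = f u + d v u) ∧
      ∀ u ∈ K, Sop d X Y K f v ≤ f u + d v u := by
  obtain ⟨-, hXY, hXK, hYK, hKfin, -, -, -⟩ := hP
  obtain ⟨k, hk⟩ := hK
  refine ⟨fun v hv => by simp [Sop, hv], fun v hv => ?_, fun v hv => ?_⟩
  · have hval : Sop d X Y K f v = sSup {c | ∃ u ∈ K, c = f u - d v u} := by
      simp [Sop, hv, Set.disjoint_left.mp hXK hv]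
    have hfin : {c | ∃ u ∈ K, c = f u - d v u}.Finite := by
      refine (hKfin.image fun u => f u - d v u).subset ?_
      rintro _ ⟨u, hu, rfl⟩
      exact ⟨u, hu, rfl⟩
    have hne : {c | ∃ u ∈ K, c = f u - d v u}.Nonempty := ⟨_, k, hk, rfl⟩
    rw [hval]
    exact ⟨hne.csSup_mem hfin,
      fun u hu => le_csSup hfin.bddAbove ⟨u, hu, rfl⟩⟩
  · have hval : Sop d X Y K f v = sInf {c | ∃ u ∈ K, c = f u + d v u} := by
      simp [Sop, Set.disjoint_right.mp hXY hv, Set.disjoint_left.mp hYK hv]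
    have hfin : {c | ∃ u ∈ K, c = f u + d v u}.Finite := by
      refine (hKfin.image fun u => f u + d v u).subset ?_
      rintro _ ⟨u, hu, rfl⟩
      exact ⟨u, hu, rfl⟩
    have hne : {c | ∃ u ∈ K, c = f u + d v u}.Nonempty := ⟨_, k, hk, rfl⟩
    rw [hval]
    exact ⟨hne.csInf_mem hfin,
      fun u hu => csInf_le hfin.bddBelow ⟨u, hu, rfl⟩⟩

theorem IsGraphBase.lip1_Sop {w : V → V → ℝ} {m : V → ℝ} {d : V → V → ℝ}
    (hG : IsGraphBase w m d) {X Y K : Set V} (hP : SalamiPartition w m X Y K) {f : V → ℝ}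
    (hf : Lip1On d K f) : Lip1 d (Sop d X Y K f) := by
  have hG' := hG
  obtain ⟨-, hwsymm, -, -, -, -, hconn, ⟨-, -, hsymm, htri, -⟩, -⟩ := hG'
  obtain ⟨hvK, hvX, hvY⟩ := Sop_spec (d := d) hP (hP.nonempty hconn) f
  obtain ⟨hcover, -, -, -, -, hXY, -, -⟩ := hP
  have hmem : ∀ v, (v ∈ X ∨ v ∈ Y) ∨ v ∈ K := fun v => hcover.symm.subset (Set.mem_univ v)
  refine hG.lip1_of_adj fun x y hxy => ?_
  rcases hmem x with (hx | hx) | hx <;> rcases hmem y with (hy | hy) | hy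
  · obtain ⟨u, hu, h⟩ := (hvX y hy).1
    linarith [(hvX x hx).2 u hu, htri x y u]
  · exact absurd (hXY x hx y hy) hxy.ne'
  · linarith [(hvX x hx).2 y hy, hvK y hy]
  · exact absurd (hXY y hy x hx) (hwsymm x y ▸ hxy.ne')
  · obtain ⟨u, hu, h⟩ := (hvY x hx).1
    linarith [(hvY y hy).2 u hu, htri y x u, hsymm x y]
  · obtain ⟨u, hu, h⟩ := (hvY x hx).1
    linarith [hvK y hy, hf u hu y hy, htri u x y, hsymm x u]
  · obtain ⟨u, hu, h⟩ := (hvX y hy).1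
    linarith [hvK x hx, hf x hx u hu, htri x y u]
  · linarith [(hvY y hy).2 x hx, hvK x hx, hsymm x y]
  · rw [hvK x hx, hvK y hy]
    exact hf x hx y hy

/-- A function that falls off like the distance from a finite set has finite superlevel sets. -/
theorem FiniteBalls.finite_superlevel {d : V → V → ℝ} (hd : FiniteBalls d)
    (hsymm : ∀ x y, d x y = d y x) {S K : Set V} (hK : K.Finite) {f : V → ℝ}
    (hf : ∀ x ∈ S, ∃ u ∈ K, f u - f x = d x u) (R : ℝ) : {x | x ∈ S ∧ R ≤ f x}.Finite := by
  refine (hK.biUnion fun u _ => hd u (f u - R)).subset ?_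
  rintro x ⟨hxS, hxR⟩
  obtain ⟨u, hu, h⟩ := hf x hxS
  refine Set.mem_biUnion hu (show d u x ≤ f u - R from ?_)
  linarith [hsymm u x]

/-- **Lemma (Constant Laplacian is zero).** On a salami with connected salami
partition `P = (X,Y,K)`, if `f ∈ ℱ(P)` has `Δf ≡ c` on `K`, then `c = 0`. -/
theorem const_laplacian_zero {V : Type*} (w : V → V → ℝ) (m : V → ℝ)
    (d : V → V → ℝ) (hS : IsSalami w m d) (X Y K : Set V)
    (hP : ConnectedSalamiPartition w m X Y K)
    (f : V → ℝ) (hf : f ∈ calF d X Y K)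
    (c : ℝ) (hc : ∀ x ∈ K, lap w m f x = c) :
    c = 0 := by
  obtain ⟨hG, hκ, -⟩ := hS
  obtain ⟨hP, -⟩ := hP
  obtain ⟨f₀, hf₀, rfl⟩ := hf
  have hLip := hG.lip1_Sop hP hf₀
  have hG' := hG
  obtain ⟨-, hwsymm, -, -, -, -, hconn, ⟨hd0, -, hsymm, -, -⟩, hballs⟩ := hG'
  obtain ⟨hvK, hvX, hvY⟩ := Sop_spec (d := d) hP (hP.nonempty hconn) f₀
  obtain ⟨hcover, -, -, -, hKfin, hXY, hX, hY⟩ := hP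
  set f := Sop d X Y K f₀
  have hmem : ∀ v, (v ∈ X ∨ v ∈ Y) ∨ v ∈ K := fun v => hcover.symm.subset (Set.mem_univ v)
  have hdown : ∀ x ∈ X ∪ K, ∃ u ∈ K, f u - f x = d x u := by
    rintro x (hx | hx)
    · obtain ⟨u, hu, h⟩ := (hvX x hx).1
      exact ⟨u, hu, by linarith [hvK u hu]⟩
    · exact ⟨x, hx, by simp [hd0]⟩
  have hup : ∀ x ∈ Y ∪ K, ∃ u ∈ K, (-f) u - (-f) x = d x u := by
    rintro x (hx | hx)
    · obtain ⟨u, hu, h⟩ := (hvY x hx).1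
      exact ⟨u, hu, by simp only [Pi.neg_apply]; linarith [hvK u hu]⟩
    · exact ⟨x, hx, by simp [hd0]⟩
  apply le_antisymm
  · refine hG.nonpos_of_le_lap hKfin (S := X ∪ K) ?_ (hX.mono Set.subset_union_left)
      (hballs.finite_superlevel hsymm hKfin hdown) fun x hx => ?_
    · rintro x (hx | hx) y hy hxy
      · rcases hmem y with (h | h) | h
        · exact absurd (Or.inl h) hy
        · exact absurd (hXY x hx y h) hxy.ne'
        · exact absurd (Or.inr h) hy
      · exact hx
    · obtain ⟨u, hu, h⟩ := hdown x hx
      exact (hc u hu).symm.le.trans (hG.lap_le_of_sub_eq_dist hκ hLip h)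
  · rw [← neg_nonpos]
    refine hG.nonpos_of_le_lap hKfin (S := Y ∪ K) ?_ (hY.mono Set.subset_union_left)
      (hballs.finite_superlevel hsymm hKfin hup) fun x hx => ?_
    · rintro x (hx | hx) y hy hxy
      · rcases hmem y with (h | h) | h
        · exact absurd (hXY y h x hx) (hwsymm x y ▸ hxy.ne')
        · exact absurd (Or.inl h) hy
        · exact absurd (Or.inr h) hy
      · exact hx
    · obtain ⟨u, hu, h⟩ := hup x hx
      rw [lap_neg, neg_le_neg_iff, ← hc u hu]
      refine hG.lap_le_of_sub_eq_dist hκ hLip ?_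
      simp only [Pi.neg_apply] at h
      linarith [hsymm x u]

end SalamiPaper
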